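/- Let M ≥ 1 and let f : ℝ^d → ℂ be Lebesgue measurable with Δ_h^M f(x) = 0 for Lebesgue-almost every (x,h) ∈ ℝ^d × ℝ^d. Then there exists a polynomial P of degree at most M−1 such that f(x) = P(x) for almost every x ∈ ℝ^d. -/

import Mathlib

open MeasureTheory

/-- The difference operator `Δ_h f(x) = f(x+h) - f(x)`. -/
def fdiff {d : ℕ} (h : Fin d → ℝ) (f : (Fin d → ℝ) → ℂ) : (Fin d → ℝ) → ℂ :=
  fun x => f (x + h) - f x


noncomputable def cf (M k : ℕ) : ℂ := (((-1 : ℤ) ^ (M - k) * M.choose k : ℤ) : ℂ)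

lemma fdiff_iter {d : ℕ} (M : ℕ) (f : (Fin d → ℝ) → ℂ) (x h : Fin d → ℝ) :
    (fdiff h)^[M] f x = ∑ k ∈ Finset.range (M + 1), cf M k * f (x + (k : ℝ) • h) := by
  have e : (fdiff h : ((Fin d → ℝ) → ℂ) → _) = fwdDiff h := rfl
  rw [e, fwdDiff_iter_eq_sum_shift]
  refine Finset.sum_congr rfl fun k _ => ?_
  rw [zsmul_eq_mul, cf, Nat.cast_smul_eq_nsmul]

lemma cf_factorial (M : ℕ) :
    ∑ k ∈ Finset.range (M + 1), cf M k * (k : ℂ) ^ M = (M.factorial : ℂ) := by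
  have := congrFun (fwdDiff_iter_eq_factorial (R := ℂ) (n := M)) 0
  rw [fwdDiff_iter_eq_sum_shift] at this
  simpa [cf, zsmul_eq_mul] using this

/-- 1D: smooth with vanishing differences has zero M-th derivative -/
lemma iterDeriv_zero_of (M : ℕ) (u : ℝ → ℂ) (hu : ContDiff ℝ M u)
    (h : ∀ t s : ℝ, ∑ k ∈ Finset.range (M + 1), cf M k * u (t + k * s) = 0) (t : ℝ) :
    iteratedDeriv M u t = 0 := by
  have h1 : (fun s : ℝ => ∑ k ∈ Finset.range (M + 1), cf M k * u (t + k * s)) = fun _ => 0 :=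
    funext fun s => h t s
  have h2 := congrArg (fun F => iteratedDeriv M F 0) h1
  have hv : ContDiff ℝ M (fun z => u (t + z)) := hu.comp (contDiff_const.add contDiff_id)
  rw [iteratedDeriv_fun_sum] at h2
  · have h3 : ∀ k : ℕ, iteratedDeriv M (fun s : ℝ => cf M k * u (t + k * s)) 0
        = cf M k * (k : ℂ) ^ M * iteratedDeriv M u t := by
      intro k
      rw [iteratedDeriv_const_mul_field]
      have := congrFun (iteratedDeriv_comp_const_smul hv (k : ℝ)) 0
      rw [this, iteratedDeriv_comp_const_add]
      simp [mul_assoc]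
    simp only [h3] at h2
    rw [← Finset.sum_mul, cf_factorial] at h2
    have h0 : iteratedDeriv M (fun _ : ℝ => (0 : ℂ)) 0 = 0 := by simp
    rw [h0] at h2
    exact (mul_eq_zero.1 h2).resolve_left (by exact_mod_cast M.factorial_ne_zero)
  · intro k _
    exact (contDiff_const.mul (hu.comp (contDiff_const.add (contDiff_const.mul contDiff_id)))).contDiffAt

lemma multilin_poly {d k : ℕ} (T : ContinuousMultilinearMap ℝ (fun _ : Fin k => (Fin d → ℝ)) ℂ) :
    ∃ P : MvPolynomial (Fin d) ℂ, P.totalDegree ≤ k ∧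
      ∀ x : Fin d → ℝ, T (fun _ => x) = MvPolynomial.eval (fun i => (x i : ℂ)) P := by
  classical
  refine ⟨∑ r : Fin k → Fin d, MvPolynomial.C (T fun j => Pi.single (r j) 1) *
    ∏ j, MvPolynomial.X (r j), ?_, ?_⟩
  · refine MvPolynomial.totalDegree_finsetSum_le fun r _ => ?_
    refine (MvPolynomial.totalDegree_mul _ _).trans ?_
    rw [MvPolynomial.totalDegree_C, zero_add]
    refine (MvPolynomial.totalDegree_finsetProd _ _).trans ?_
    simp
  · intro x
    have hx : x = ∑ i, x i • (Pi.single i (1 : ℝ) : Fin d → ℝ) := by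
      ext j; simp [Finset.sum_apply, Pi.single_apply]
    conv_lhs => rw [hx]
    have := T.toMultilinearMap.map_sum (fun (_ : Fin k) (i : Fin d) =>
      x i • (Pi.single i (1 : ℝ) : Fin d → ℝ))
    simp only [ContinuousMultilinearMap.coe_coe] at this
    rw [this, map_sum]
    refine Finset.sum_congr rfl fun r _ => ?_
    have := T.map_smul_univ (fun j => x (r j)) (fun j => Pi.single (r j) (1 : ℝ))
    rw [this]
    simp [mul_comm]

lemma smooth_poly {d : ℕ} (n : ℕ) (g : (Fin d → ℝ) → ℂ) (hg : ContDiff ℝ (n + 1 : ℕ) g)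
    (h : ∀ x h, (fdiff h)^[n + 1] g x = 0) :
    ∃ P : MvPolynomial (Fin d) ℂ, P.totalDegree ≤ n ∧
      ∀ x : Fin d → ℝ, g x = MvPolynomial.eval (fun i => (x i : ℂ)) P := by
  choose Q hQd hQ using fun k : ℕ => multilin_poly (iteratedFDeriv ℝ k g 0)
  refine ⟨∑ k ∈ Finset.range (n + 1), MvPolynomial.C (((k.factorial : ℝ)⁻¹ : ℝ) : ℂ) * Q k, ?_, ?_⟩
  · refine MvPolynomial.totalDegree_finsetSum_le fun k hk => ?_
    refine (MvPolynomial.totalDegree_mul _ _).trans ?_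
    rw [MvPolynomial.totalDegree_C, zero_add]
    exact (hQd k).trans (by simp at hk; omega)
  · intro x
    set L : ℝ →L[ℝ] (Fin d → ℝ) := ContinuousLinearMap.toSpanSingleton ℝ x with hL
    set u : ℝ → ℂ := g ∘ L with hu
    have huc : ContDiff ℝ (n + 1 : ℕ) u := hg.comp L.contDiff
    have hz : ∀ t, iteratedDeriv (n + 1) u t = 0 := by
      apply iterDeriv_zero_of _ _ huc
      intro t s
      have := h (t • x) (s • x)
      rw [fdiff_iter] at this
      rw [← this]
      refine Finset.sum_congr rfl fun k _ => ?_
      simp [hu, hL, ContinuousLinearMap.toSpanSingleton_apply, add_smul, smul_smul]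
    have hk : ∀ k ∈ Finset.range (n + 1), iteratedDeriv k u 0 =
        MvPolynomial.eval (fun i => (x i : ℂ)) (Q k) := by
      intro k hk
      have hkn : (k : WithTop ℕ∞) ≤ (n + 1 : ℕ) := by
        simp at hk; exact_mod_cast Nat.le_succ_of_le hk
      rw [← hQ, iteratedDeriv_eq_iteratedFDeriv, hu, L.iteratedFDeriv_comp_right hg _ hkn]
      simp [hL, ContinuousLinearMap.toSpanSingleton_apply]
    have hI : ∀ k ≤ n + 1, ∀ y ∈ Set.Icc (0 : ℝ) 1,
        iteratedDerivWithin k u (Set.Icc 0 1) y = iteratedDeriv k u y := by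
      intro k hk y hy
      exact iteratedDerivWithin_eq_iteratedDeriv (uniqueDiffOn_Icc zero_lt_one)
        (huc.of_le (by exact_mod_cast hk)).contDiffAt hy
    have ht := taylor_mean_remainder_bound (f := u) (a := 0) (b := 1) (C := 0) (x := 1) (n := n)
      zero_le_one (by exact_mod_cast huc.contDiffOn) (by simp) (by
        intro y hy; rw [hI _ le_rfl y hy, hz]; simp)
    simp only [zero_mul, zero_div, norm_le_zero_iff, sub_eq_zero] at ht
    rw [taylor_within_apply] at ht
    have hu1 : u 1 = g x := by simp [hu, hL]
    rw [← hu1, ht, map_sum]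
    refine Finset.sum_congr rfl fun k hk' => ?_
    rw [hI k (by simp at hk'; omega) 0 (by simp), hk k hk']
    simp

lemma loc_int {d : ℕ} (M : ℕ) (f : (Fin d → ℝ) → ℂ) (hf : Measurable f)
    (h : ∀ᵐ x ∂(volume : Measure (Fin d → ℝ)), ∀ᵐ y ∂(volume : Measure (Fin d → ℝ)),
      (fdiff y)^[M] f x = 0) : LocallyIntegrable f volume := by
  rw [locallyIntegrable_iff]
  intro S hS
  obtain ⟨R, hR⟩ := hS.isBounded.subset_closedBall 0
  set B : Set (Fin d → ℝ) := Metric.closedBall 0 (R + M) with hB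
  set A : ℕ → Set (Fin d → ℝ) := fun K => B ∩ {y | (K : ℝ) < ‖f y‖} with hA
  have hBfin : volume B ≠ ⊤ := measure_closedBall_lt_top.ne
  have hAm : ∀ K, MeasurableSet (A K) := fun K =>
    Metric.isClosed_closedBall.measurableSet.inter (measurableSet_lt measurable_const hf.norm)
  have hAt : Filter.Tendsto (fun K => (M : ENNReal) * volume (A K)) Filter.atTop (nhds 0) := by
    have h1 := tendsto_measure_iInter_atTop (μ := (volume : Measure (Fin d → ℝ))) (s := A)
      (fun K => (hAm K).nullMeasurableSet)
      (fun a b hab y hy => ⟨hy.1, lt_of_le_of_lt (Nat.cast_le (α := ℝ).2 hab) hy.2⟩)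
      ⟨0, (measure_mono Set.inter_subset_left).trans_lt hBfin.lt_top |>.ne⟩
    have h2 : (⋂ n, A n) = ∅ := by
      ext y
      simp only [Set.mem_iInter, Set.mem_empty_iff_false, iff_false, not_forall]
      obtain ⟨n, hn⟩ := exists_nat_gt ‖f y‖
      exact ⟨n, fun hy => absurd hy.2 (not_lt.2 hn.le)⟩
    rw [h2, measure_empty] at h1
    have := ENNReal.Tendsto.const_mul (a := (M : ENNReal)) h1 (Or.inr (by simp))
    simpa using this
  have hpos : 0 < volume (Metric.ball (0 : Fin d → ℝ) 1) := Metric.measure_ball_pos _ _ one_pos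
  obtain ⟨K, hK⟩ := (hAt.eventually (gt_mem_nhds hpos)).exists
  refine Measure.integrableOn_of_bounded (M := ∑ k ∈ Finset.Icc 1 M, ‖cf M k‖ * K)
    hS.measure_lt_top.ne hf.aestronglyMeasurable ?_
  rw [ae_restrict_iff' hS.measurableSet]
  filter_upwards [h] with x hx hxS
  have hxR : ‖x‖ ≤ R := by simpa using hR hxS
  set U : Set (Fin d → ℝ) := ⋃ k ∈ Finset.Icc 1 M, (fun y => x + (k : ℝ) • y) ⁻¹' A K with hU
  have hUv : volume U < volume (Metric.ball (0 : Fin d → ℝ) 1) := by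
    refine lt_of_le_of_lt ?_ hK
    refine (measure_biUnion_finset_le _ _).trans ?_
    have : ∀ k ∈ Finset.Icc 1 M,
        volume ((fun y : Fin d → ℝ => x + (k : ℝ) • y) ⁻¹' A K) ≤ volume (A K) := by
      intro k hk
      have hk1 : (1 : ℝ) ≤ k := by exact_mod_cast (Finset.mem_Icc.1 hk).1
      have e : (fun y : Fin d → ℝ => x + (k : ℝ) • y) ⁻¹' A K =
        (fun y => (k : ℝ) • y) ⁻¹' ((fun y => x + y) ⁻¹' A K) := rfl
      rw [e, Measure.addHaar_preimage_smul _ (by positivity), measure_preimage_add]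
      refine mul_le_of_le_one_left (by simp) ?_
      rw [ENNReal.ofReal_le_one, abs_of_nonneg (by positivity)]
      exact inv_le_one_of_one_le₀ (one_le_pow₀ hk1)
    refine (Finset.sum_le_sum this).trans ?_
    simp
  have hex : ∃ y ∈ Metric.ball (0 : Fin d → ℝ) 1, y ∉ U ∧ (fdiff y)^[M] f x = 0 := by
    by_contra! hcon
    have hle : volume (Metric.ball (0 : Fin d → ℝ) 1) ≤ volume U := by
      refine measure_mono_ae ?_
      filter_upwards [hx] with y hy hyb
      by_contra hyU
      exact hcon y hyb hyU hy
    exact absurd hUv (not_lt.2 hle)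
  obtain ⟨y, hyb, hyU, hy⟩ := hex
  have hbd : ∀ k ∈ Finset.Icc 1 M, ‖f (x + (k : ℝ) • y)‖ ≤ K := by
    intro k hk
    by_contra hlt
    refine hyU ?_
    simp only [hU, Set.mem_iUnion]
    refine ⟨k, hk, ?_, not_le.1 hlt⟩
    simp only [hB, mem_closedBall_zero_iff]
    refine (norm_add_le _ _).trans (add_le_add hxR ?_)
    rw [norm_smul]
    have hkM : (k : ℝ) ≤ M := by exact_mod_cast (Finset.mem_Icc.1 hk).2
    have : ‖y‖ ≤ 1 := (mem_ball_zero_iff.1 hyb).le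
    simp only [RCLike.norm_natCast]
    nlinarith [norm_nonneg y, (Nat.cast_nonneg k : (0 : ℝ) ≤ k)]
  have hr : Finset.range (M + 1) = insert 0 (Finset.Icc 1 M) := by
    ext k; simp; omega
  rw [fdiff_iter, hr, Finset.sum_insert (by simp)] at hy
  have h0 : ‖cf M 0 * f x‖ = ‖f x‖ := by simp [cf]
  have h1 : cf M 0 * f x = -∑ k ∈ Finset.Icc 1 M, cf M k * f (x + (k : ℝ) • y) := by
    simpa using eq_neg_of_add_eq_zero_left hy
  rw [← h0, h1, norm_neg]
  refine (norm_sum_le _ _).trans (Finset.sum_le_sum fun k hk => ?_)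
  rw [norm_mul]
  exact mul_le_mul_of_nonneg_left (hbd k hk) (norm_nonneg _)

lemma exists_smooth {d : ℕ} (M : ℕ) (f : (Fin d → ℝ) → ℂ) (hf : LocallyIntegrable f volume)
    (h : ∀ᵐ x ∂(volume : Measure (Fin d → ℝ)), ∀ᵐ y ∂(volume : Measure (Fin d → ℝ)),
      (fdiff y)^[M] f x = 0) :
    ∃ g : (Fin d → ℝ) → ℂ, ContDiff ℝ (M : ℕ) g ∧ f =ᵐ[volume] g := by
  let b : ContDiffBump (0 : Fin d → ℝ) := default
  set φ : (Fin d → ℝ) → ℂ := fun x => ((b.normed volume x : ℝ) : ℂ) with hφ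
  have hφs : ContDiff ℝ ((M : ℕ∞) : WithTop ℕ∞) φ :=
    Complex.ofRealCLM.contDiff.comp b.contDiff_normed
  have hφc : HasCompactSupport φ := b.hasCompactSupport_normed.comp_left (g := Complex.ofReal) rfl
  have hφ1 : ∫ x, φ x = 1 := by
    rw [hφ, integral_complex_ofReal, b.integral_normed]; simp
  have hφi : Integrable φ volume := hφs.continuous.integrable_of_hasCompactSupport hφc
  let L := ContinuousLinearMap.mul ℝ ℂ
  let ψ : ℕ → (Fin d → ℝ) → ℂ := fun k t => φ ((-(k : ℝ))⁻¹ • t)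
  have hψs : ∀ k, ContDiff ℝ ((M : ℕ∞) : WithTop ℕ∞) (ψ k) := fun k =>
    hφs.comp (contDiff_const_smul _)
  have hψc : ∀ k, 1 ≤ k → HasCompactSupport (ψ k) := fun k hk =>
    hφc.comp_smul (inv_ne_zero (neg_ne_zero.2 (by positivity)))
  let G : ℕ → (Fin d → ℝ) → ℂ := fun k => convolution f (ψ k) L volume
  have hGs : ∀ k, 1 ≤ k → ContDiff ℝ ((M : ℕ∞) : WithTop ℕ∞) (G k) := fun k hk =>
    (hψc k hk).contDiff_convolution_right L hf (hψs k)
  have key : ∀ k : ℕ, 1 ≤ k → ∀ x, Integrable (fun y => f (x + (k : ℝ) • y) * φ y) volume ∧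
      ∫ y, f (x + (k : ℝ) • y) * φ y =
        |((-(k : ℝ)) ^ Module.finrank ℝ (Fin d → ℝ))⁻¹| • G k x := by
    intro k hk x
    have hk0 : (-(k : ℝ)) ≠ 0 := neg_ne_zero.2 (by positivity)
    have hi : Integrable (fun t => f (x - t) * ψ k t) volume :=
      ((hψc k hk).convolutionExists_right L hf (hψs k).continuous x).integrable_swap
    have e : (fun y => f (x + (k : ℝ) • y) * φ y) =
        fun y => (fun t => f (x - t) * ψ k t) ((-(k : ℝ)) • y) := by
      funext y
      simp only [ψ, smul_smul (-(k : ℝ))⁻¹, inv_mul_cancel₀ hk0, one_smul]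
      rw [neg_smul, sub_neg_eq_add]
    rw [e]
    refine ⟨hi.comp_smul hk0, ?_⟩
    rw [Measure.integral_comp_smul volume (fun t => f (x - t) * ψ k t)]
    congr 1
    exact (convolution_eq_swap L).symm
  refine ⟨fun x => -(cf M 0)⁻¹ * ∑ k ∈ Finset.Icc 1 M, cf M k *
    (|((-(k : ℝ)) ^ Module.finrank ℝ (Fin d → ℝ))⁻¹| • G k x), ?_, ?_⟩
  · refine contDiff_const.mul (ContDiff.sum fun k hk => contDiff_const.mul ?_)
    exact (hGs k (Finset.mem_Icc.1 hk).1).const_smul _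
  · filter_upwards [h] with x hx
    have hc0 : cf M 0 ≠ 0 := by simp [cf]
    have hr : Finset.range (M + 1) = insert 0 (Finset.Icc 1 M) := by
      ext k; simp; omega
    have h0 : ∫ y, (∑ k ∈ Finset.Icc 1 M, cf M k * (f (x + (k : ℝ) • y) * φ y)) =
        ∫ y, -(cf M 0 * f x) * φ y := by
      refine integral_congr_ae ?_
      filter_upwards [hx] with y hy
      rw [fdiff_iter, hr, Finset.sum_insert (by simp)] at hy
      simp only [Nat.cast_zero, zero_smul, add_zero] at hy
      rw [neg_eq_of_add_eq_zero_right hy, Finset.sum_mul]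
      simp only [mul_assoc]
    rw [integral_finsetSum _ (fun k hk => ((key k (Finset.mem_Icc.1 hk).1 x).1.const_mul _)),
      integral_const_mul, hφ1, mul_one] at h0
    have h2 : ∑ k ∈ Finset.Icc 1 M, ∫ y, cf M k * (f (x + (k : ℝ) • y) * φ y) =
        ∑ k ∈ Finset.Icc 1 M, cf M k *
          (|((-(k : ℝ)) ^ Module.finrank ℝ (Fin d → ℝ))⁻¹| • G k x) := by
      refine Finset.sum_congr rfl fun k hk => ?_
      rw [integral_const_mul, (key k (Finset.mem_Icc.1 hk).1 x).2]
    rw [← h2, h0]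
    field_simp

theorem stmt_2 (d M : ℕ) (hM : 1 ≤ M) (f : (Fin d → ℝ) → ℂ) (hf : Measurable f)
    (h : ∀ᵐ q ∂(volume : Measure ((Fin d → ℝ) × (Fin d → ℝ))), (fdiff q.2)^[M] f q.1 = 0) :
    ∃ P : MvPolynomial (Fin d) ℂ, P.totalDegree ≤ M - 1 ∧
      ∀ᵐ x ∂(volume : Measure (Fin d → ℝ)),
        f x = MvPolynomial.eval (fun i => (x i : ℂ)) P := by
  rw [Measure.volume_eq_prod] at h
  have h1 := Measure.ae_ae_of_ae_prod h
  have h2 := Measure.ae_ae_of_ae_prod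
    ((Measure.measurePreserving_swap (μ := (volume : Measure (Fin d → ℝ)))
      (ν := (volume : Measure (Fin d → ℝ)))).quasiMeasurePreserving.ae h)
  simp only [Prod.fst_swap, Prod.snd_swap] at h2
  obtain ⟨g, hg, hfg⟩ := exists_smooth M f (loc_int M f hf h1) h1
  have hgc := hg.continuous
  have h3 : ∀ᵐ y ∂(volume : Measure (Fin d → ℝ)), ∀ x, (fdiff y)^[M] g x = 0 := by
    filter_upwards [h2] with y hy
    have hc : Continuous fun x => (fdiff y)^[M] g x := by
      simp only [fdiff_iter]; fun_prop
    refine congrFun ((hc.ae_eq_iff_eq volume (continuous_const (y := (0 : ℂ)))).1 ?_)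
    have h4 : ∀ᵐ x ∂(volume : Measure (Fin d → ℝ)), ∀ k : ℕ,
        f (x + (k : ℝ) • y) = g (x + (k : ℝ) • y) := by
      rw [ae_all_iff]
      intro k
      exact (measurePreserving_add_right volume ((k : ℝ) • y)).quasiMeasurePreserving.ae hfg
    filter_upwards [hy, h4] with x hx hx4
    rw [fdiff_iter] at hx ⊢
    simpa only [hx4] using hx
  have h5 : ∀ x y, (fdiff y)^[M] g x = 0 := by
    intro x
    have hc : Continuous fun y => (fdiff y)^[M] g x := by
      simp only [fdiff_iter]; fun_prop
    refine congrFun ((hc.ae_eq_iff_eq volume (continuous_const (y := (0 : ℂ)))).1 ?_)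
    filter_upwards [h3] with y hy using hy x
  obtain ⟨n, rfl⟩ : ∃ n, M = n + 1 := ⟨M - 1, by omega⟩
  obtain ⟨P, hP, hPe⟩ := smooth_poly n g hg h5
  refine ⟨P, by simpa using hP, ?_⟩
  filter_upwards [hfg] with x hx
  rw [hx, hPe]
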